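/- Let ν be a σ-finite measure on (0,∞) with ∫ (y ∧ 1) ν(dy) < ∞. Then for all 0 ≤ s < t < ∞ and all λ ≥ 0 the quantity Ψ̃_{s,t}(λ) := ∫_{(0,∞)} (1 − e^{−y·Ψ_{s,t}(λ)}) ν(dy) is finite, and the composition property Ψ̃_{t₁,t₂}(Ψ_{t₂,t₃}(λ)) = Ψ̃_{t₁,t₃}(λ) holds for all 0 ≤ t₁ < t₂ < t₃ < ∞ and λ ≥ 0. -/

import Mathlib

open MeasureTheory Filter Set

/-- `C(s,t) = ∫_s^t (σ²(v)/2)·exp(∫_0^v β(u)du) dv` -/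
noncomputable def Cf (σ β : ℝ → ℝ) (s t : ℝ) : ℝ :=
  ∫ v in s..t, σ v ^ 2 / 2 * Real.exp (∫ u in (0:ℝ)..v, β u)

/-- `B(s,t) = exp(−∫_s^t β(v)dv)` -/
noncomputable def Bf (β : ℝ → ℝ) (s t : ℝ) : ℝ :=
  Real.exp (-∫ v in s..t, β v)

/-- `p(s,t) = 1/(B(0,t)·C(s,t))` -/
noncomputable def pf (σ β : ℝ → ℝ) (s t : ℝ) : ℝ :=
  1 / (Bf β 0 t * Cf σ β s t)

/-- `γ(s,t) = 1/(B(0,s)·C(s,t))` -/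
noncomputable def gf (σ β : ℝ → ℝ) (s t : ℝ) : ℝ :=
  1 / (Bf β 0 s * Cf σ β s t)

/-- `Ψ_{s,t}(λ) = γ(s,t)·λ/(p(s,t)+λ)` -/
noncomputable def Psi (σ β : ℝ → ℝ) (s t l : ℝ) : ℝ :=
  gf σ β s t * l / (pf σ β s t + l)

/-- `Ψ̃_{s,t}(λ) = ∫_{(0,∞)} (1 − e^{−y·Ψ_{s,t}(λ)}) ν(dy)` -/
noncomputable def Psit (σ β : ℝ → ℝ) (ν : Measure ℝ) (s t l : ℝ) : ℝ :=
  ∫ y, (1 - Real.exp (-(y * Psi σ β s t l))) ∂ν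

lemma continuousOn_Cf_integrand {σ β : ℝ → ℝ} (hσc : ContinuousOn σ (Ici 0))
    (hβc : ContinuousOn β (Ici 0)) {s t : ℝ} (hs : 0 ≤ s) (hst : s ≤ t) :
    ContinuousOn (fun v => σ v ^ 2 / 2 * Real.exp (∫ u in (0:ℝ)..v, β u)) (Icc s t) := by
  have hsub : Icc s t ⊆ Ici 0 := fun x hx => hs.trans hx.1
  have hprim : ContinuousOn (fun v => ∫ u in (0:ℝ)..v, β u) (uIcc 0 t) := by
    apply intervalIntegral.continuousOn_primitive_interval
    rw [uIcc_of_le (hs.trans hst)]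
    exact (hβc.mono fun x hx => hx.1).integrableOn_Icc
  rw [uIcc_of_le (hs.trans hst)] at hprim
  exact (((hσc.mono hsub).pow 2).div_const 2).mul
    (hprim.mono (Icc_subset_Icc_left hs)).rexp

lemma Cf_pos {σ β : ℝ → ℝ} (hσc : ContinuousOn σ (Ici 0)) (hβc : ContinuousOn β (Ici 0))
    (hσpos : ∀ x ∈ Ici (0:ℝ), 0 < σ x) {s t : ℝ} (hs : 0 ≤ s) (hst : s < t) :
    0 < Cf σ β s t := by
  refine intervalIntegral.intervalIntegral_pos_of_pos_on
    ((continuousOn_Cf_integrand hσc hβc hs hst.le).intervalIntegrable_of_Icc hst.le)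
    (fun x hx => ?_) hst
  have := hσpos x (hs.trans hx.1.le)
  positivity

lemma Cf_add_Cf {σ β : ℝ → ℝ} (hσc : ContinuousOn σ (Ici 0)) (hβc : ContinuousOn β (Ici 0))
    {r s t : ℝ} (hr : 0 ≤ r) (hrs : r ≤ s) (hst : s ≤ t) :
    Cf σ β r s + Cf σ β s t = Cf σ β r t :=
  intervalIntegral.integral_add_adjacent_intervals
    ((continuousOn_Cf_integrand hσc hβc hr hrs).intervalIntegrable_of_Icc hrs)
    ((continuousOn_Cf_integrand hσc hβc (hr.trans hrs) hst).intervalIntegrable_of_Icc hst)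

lemma Bf_pos (β : ℝ → ℝ) (s t : ℝ) : 0 < Bf β s t := Real.exp_pos _

lemma Psi_eq {σ β : ℝ → ℝ} {s t l : ℝ} (hC : 0 < Cf σ β s t) (hl : 0 ≤ l) :
    Psi σ β s t l = Bf β 0 t * l / (Bf β 0 s * (1 + Bf β 0 t * Cf σ β s t * l)) := by
  have hs := Bf_pos β 0 s
  have ht := Bf_pos β 0 t
  have h : 0 < 1 + Bf β 0 t * Cf σ β s t * l := by positivity
  unfold Psi gf pf
  have h' : 1 / (Bf β 0 t * Cf σ β s t) + l
      = (1 + Bf β 0 t * Cf σ β s t * l) / (Bf β 0 t * Cf σ β s t) := by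
    field_simp
  rw [h']
  field_simp

lemma Psi_nonneg {σ β : ℝ → ℝ} {s t l : ℝ} (hC : 0 < Cf σ β s t) (hl : 0 ≤ l) :
    0 ≤ Psi σ β s t l := by
  have hs := Bf_pos β 0 s
  have ht := Bf_pos β 0 t
  rw [Psi_eq hC hl]
  positivity

lemma Psi_comp {σ β : ℝ → ℝ} {r s t l : ℝ} (hrs : 0 < Cf σ β r s) (hst : 0 < Cf σ β s t)
    (hadd : Cf σ β r s + Cf σ β s t = Cf σ β r t) (hl : 0 ≤ l) :
    Psi σ β r s (Psi σ β s t l) = Psi σ β r t l := by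
  have hr := Bf_pos β 0 r
  have hs := Bf_pos β 0 s
  have ht := Bf_pos β 0 t
  rw [Psi_eq hrs (Psi_nonneg hst hl), Psi_eq hst hl, Psi_eq (by linarith : 0 < Cf σ β r t) hl,
    ← hadd]
  generalize Bf β 0 r = a at *
  generalize Bf β 0 s = b at *
  generalize Bf β 0 t = c at *
  generalize Cf σ β r s = C at *
  generalize Cf σ β s t = D at *
  have h1 : 0 < 1 + c * D * l := by positivity
  have h2 : 0 < 1 + c * (C + D) * l := by positivity
  have h3 : 1 + b * C * (c * l / (b * (1 + c * D * l)))
      = (1 + c * (C + D) * l) / (1 + c * D * l) := by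
    field_simp
    ring
  rw [h3]
  field_simp

lemma integrable_one_sub_exp_neg_mul {ν : Measure ℝ} (hνsupp : ν {y : ℝ | ¬ 0 < y} = 0)
    (hνint : (∫⁻ y, ENNReal.ofReal (min y 1) ∂ν) < ⊤) {k : ℝ} (hk : 0 ≤ k) :
    Integrable (fun y => 1 - Real.exp (-(y * k))) ν := by
  have hpos : ∀ᵐ y ∂ν, 0 < y := hνsupp
  have hmin : Integrable (fun y : ℝ => min y 1) ν := by
    refine ⟨by fun_prop, ?_⟩
    rw [hasFiniteIntegral_iff_ofReal]
    · exact hνint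
    · filter_upwards [hpos] with y hy
      exact le_min hy.le zero_le_one
  refine (hmin.const_mul (k + 1)).mono' (by fun_prop) ?_
  filter_upwards [hpos] with y hy
  have hyk : 0 ≤ y * k := by positivity
  have h1 : Real.exp (-(y * k)) ≤ 1 := Real.exp_le_one_iff.2 (by linarith)
  have h2 := Real.add_one_le_exp (-(y * k))
  have h3 := Real.exp_pos (-(y * k))
  rw [Real.norm_of_nonneg (by linarith)]
  rcases le_total y 1 with h | h
  · rw [min_eq_left h]
    nlinarith
  · rw [min_eq_right h]
    linarith

/-- For a σ-finite measure `ν` on `(0,∞)` with `∫ (y∧1) ν(dy) < ∞`, the quantity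
`Ψ̃_{s,t}(λ)` is finite (the integrand is `ν`-integrable), and
`Ψ̃_{t₁,t₂}(Ψ_{t₂,t₃}(λ)) = Ψ̃_{t₁,t₃}(λ)`. -/
theorem stmt_17 (σ β : ℝ → ℝ)
    (hσc : ContinuousOn σ (Set.Ici 0)) (hβc : ContinuousOn β (Set.Ici 0))
    (hσpos : ∀ x ∈ Set.Ici (0:ℝ), 0 < σ x) (hβnn : ∀ x ∈ Set.Ici (0:ℝ), 0 ≤ β x)
    (ν : Measure ℝ) (hσfin : SigmaFinite ν) (hνsupp : ν {y : ℝ | ¬ 0 < y} = 0)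
    (hνint : (∫⁻ y, ENNReal.ofReal (min y 1) ∂ν) < ⊤) :
    (∀ s t l : ℝ, 0 ≤ s → s < t → 0 ≤ l →
      Integrable (fun y => 1 - Real.exp (-(y * Psi σ β s t l))) ν) ∧
    (∀ t₁ t₂ t₃ l : ℝ, 0 ≤ t₁ → t₁ < t₂ → t₂ < t₃ → 0 ≤ l →
      Psit σ β ν t₁ t₂ (Psi σ β t₂ t₃ l) = Psit σ β ν t₁ t₃ l) := by
  refine ⟨fun s t l hs hst hl => ?_, fun t₁ t₂ t₃ l h₁ h₁₂ h₂₃ hl => ?_⟩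
  · exact integrable_one_sub_exp_neg_mul hνsupp hνint
      (Psi_nonneg (Cf_pos hσc hβc hσpos hs hst) hl)
  · unfold Psit
    rw [Psi_comp (Cf_pos hσc hβc hσpos h₁ h₁₂)
      (Cf_pos hσc hβc hσpos (h₁.trans h₁₂.le) h₂₃)
      (Cf_add_Cf hσc hβc h₁ h₁₂.le h₂₃.le) hl]
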